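/- Let S be a pomonoid such that all generators in Pos-S are principally weakly po-flat. Then S is regular: for every s ∈ S there exists x ∈ S with s = sxs. -/

import Mathlib

/-- A right `S`-poset: a poset with a compatible monotone right `S`-action. -/
structure SPoset (S : Type) [Monoid S] [PartialOrder S] where
  carrier : Type
  le : carrier → carrier → Prop
  le_refl : ∀ a, le a a
  le_trans : ∀ a b c, le a b → le b c → le a c
  le_antisymm : ∀ a b, le a b → le b a → a = b
  act : carrier → S → carrier
  act_one : ∀ a, act a 1 = a
  act_mul : ∀ a s t, act (act a s) t = act a (s * t)
  act_mono_left : ∀ a b s, le a b → le (act a s) (act b s)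
  act_mono_right : ∀ a s t, s ≤ t → le (act a s) (act a t)

/-- A morphism of right `S`-posets: a monotone action-preserving map. -/
structure SPosetHom {S : Type} [Monoid S] [PartialOrder S] (A B : SPoset S) where
  toFun : A.carrier → B.carrier
  mono : ∀ a b, A.le a b → B.le (toFun a) (toFun b)
  map_act : ∀ a s, toFun (A.act a s) = B.act (toFun a) s

/-- `G` is a generator in `Pos`-`S`: the functor `Pos_S(G, −)` is faithful. -/
def IsGenerator {S : Type} [Monoid S] [PartialOrder S] (G : SPoset S) : Prop :=
  ∀ (X Y : SPoset S) (f g : SPosetHom X Y), f.toFun ≠ g.toFun →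
    ∃ h : SPosetHom G X, f.toFun ∘ h.toFun ≠ g.toFun ∘ h.toFun

/-- An `S`-tossing witnessing `a ⊗ b ≤ a' ⊗ b'` in `A ⊗_S B` for `B ⊆ S`
a left `S`-subposet of `S`. -/
def SPoset.TossLe {S : Type} [Monoid S] [PartialOrder S] (A : SPoset S)
    (B : Set S) (a : A.carrier) (b : S) (a' : A.carrier) (b' : S) : Prop :=
  ∃ n : ℕ, ∃ c : Fin (n + 1) → A.carrier, ∃ s t : Fin (n + 1) → S,
    ∃ u : Fin (n + 2) → S,
    u 0 = b ∧ u (Fin.last (n + 1)) = b' ∧ (∀ i, u i ∈ B) ∧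
    A.le a (A.act (c 0) (s 0)) ∧
    (∀ i : Fin n, A.le (A.act (c i.castSucc) (t i.castSucc)) (A.act (c i.succ) (s i.succ))) ∧
    A.le (A.act (c (Fin.last n)) (t (Fin.last n))) a' ∧
    (∀ i : Fin (n + 1), s i * u i.castSucc ≤ t i * u i.succ)

/-- `A` is principally weakly po-flat: `as ≤ a's` implies `a ⊗ s ≤ a' ⊗ s`
in `A ⊗_S Ss`. -/
def SPoset.PWPoFlat {S : Type} [Monoid S] [PartialOrder S] (A : SPoset S) : Prop :=
  ∀ (a a' : A.carrier) (s : S), A.le (A.act a s) (A.act a' s) →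
    A.TossLe {r : S | ∃ w : S, r = w * s} a s a' s

namespace SPoset

/-- The preorder on two copies of `S` whose antisymmetrization is the amalgamated coproduct
of `S` with itself over `I`. -/
def AmalgLe {S : Type} [PartialOrder S] (I : Set S) (p q : Bool × S) : Prop :=
  p.2 ≤ q.2 ∧ (p.1 = q.1 ∨ ∃ i ∈ I, p.2 ≤ i ∧ i ≤ q.2)

theorem AmalgLe.refl {S : Type} [PartialOrder S] (I : Set S) (p : Bool × S) : AmalgLe I p p :=
  ⟨_root_.le_refl _, Or.inl rfl⟩

theorem AmalgLe.trans {S : Type} [PartialOrder S] {I : Set S} {p q r : Bool × S}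
    (hpq : AmalgLe I p q) (hqr : AmalgLe I q r) : AmalgLe I p r := by
  refine ⟨hpq.1.trans hqr.1, ?_⟩
  rcases hpq.2 with h | ⟨i, hi, h₁, h₂⟩
  · rcases hqr.2 with h' | ⟨i, hi, h₁, h₂⟩
    · exact Or.inl (h.trans h')
    · exact Or.inr ⟨i, hi, hpq.1.trans h₁, h₂⟩
  · exact Or.inr ⟨i, hi, h₁, h₂.trans hqr.1⟩

theorem AmalgLe.mul_right {S : Type} [Monoid S] [PartialOrder S]
    [CovariantClass S S (Function.swap (· * ·)) (· ≤ ·)] {I : Set S}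
    (hI : ∀ i ∈ I, ∀ t, i * t ∈ I) {p q : Bool × S} (h : AmalgLe I p q) (t : S) :
    AmalgLe I (p.1, p.2 * t) (q.1, q.2 * t) := by
  have mono {a b : S} (hab : a ≤ b) : a * t ≤ b * t :=
    CovariantClass.elim (μ := Function.swap (· * ·)) t hab
  refine ⟨mono h.1, h.2.imp id ?_⟩
  rintro ⟨i, hi, h₁, h₂⟩
  exact ⟨i * t, hI i hi t, mono h₁, mono h₂⟩

/-- Two elements are identified when each is below the other for `AmalgLe I`. -/
def amalgSetoid {S : Type} [PartialOrder S] (I : Set S) : Setoid (Bool × S) where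
  r p q := AmalgLe I p q ∧ AmalgLe I q p
  iseqv :=
    { refl := fun p => ⟨AmalgLe.refl I p, AmalgLe.refl I p⟩
      symm := fun h => ⟨h.2, h.1⟩
      trans := fun h k => ⟨h.1.trans k.1, k.2.trans h.2⟩ }

/-- The amalgamated coproduct of two copies of `S` over the right ideal `I`. -/
def amalg {S : Type} [Monoid S] [PartialOrder S]
    [CovariantClass S S (· * ·) (· ≤ ·)]
    [CovariantClass S S (Function.swap (· * ·)) (· ≤ ·)]
    (I : Set S) (hI : ∀ i ∈ I, ∀ t, i * t ∈ I) : SPoset S where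
  carrier := Quotient (amalgSetoid I)
  le := Quotient.lift₂ (AmalgLe I) fun _ _ _ _ h h' =>
    propext ⟨fun k => (h.2.trans k).trans h'.1, fun k => (h.1.trans k).trans h'.2⟩
  le_refl := by
    rintro ⟨p⟩
    exact AmalgLe.refl I p
  le_trans := by
    rintro ⟨p⟩ ⟨q⟩ ⟨r⟩ h h'
    exact AmalgLe.trans h h'
  le_antisymm := by
    rintro ⟨p⟩ ⟨q⟩ h h'
    exact Quotient.sound ⟨h, h'⟩
  act a t := Quotient.map (sa := amalgSetoid I) (sb := amalgSetoid I)
    (fun p => (p.1, p.2 * t)) (fun _ _ h => ⟨h.1.mul_right hI t, h.2.mul_right hI t⟩) a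
  act_one := by
    rintro ⟨p⟩
    exact congrArg (Quotient.mk (amalgSetoid I)) (Prod.ext rfl (mul_one p.2))
  act_mul := by
    rintro ⟨p⟩ s t
    exact congrArg (Quotient.mk (amalgSetoid I)) (Prod.ext rfl (mul_assoc p.2 s t))
  act_mono_left := by
    rintro ⟨p⟩ ⟨q⟩ s h
    exact AmalgLe.mul_right hI h s
  act_mono_right := by
    rintro ⟨p⟩ s t h
    exact ⟨CovariantClass.elim (μ := (· * ·)) p.2 h, Or.inl rfl⟩

theorem isGenerator_amalg {S : Type} [Monoid S] [PartialOrder S]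
    [CovariantClass S S (· * ·) (· ≤ ·)]
    [CovariantClass S S (Function.swap (· * ·)) (· ≤ ·)]
    (I : Set S) (hI : ∀ i ∈ I, ∀ t, i * t ∈ I) : IsGenerator (amalg I hI) := by
  intro X Y f g hfg
  obtain ⟨x, hx⟩ := Function.ne_iff.mp hfg
  let h : SPosetHom (amalg I hI) X :=
    { toFun := Quotient.lift (fun p : Bool × S => X.act x p.2) fun p q h =>
        congrArg (X.act x) (_root_.le_antisymm h.1.1 h.2.1)
      mono := by
        rintro ⟨p⟩ ⟨q⟩ h
        exact X.act_mono_right x _ _ h.1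
      map_act := by
        rintro ⟨p⟩ s
        exact (X.act_mul x p.2 s).symm }
  refine ⟨h, fun he => hx ?_⟩
  have key : f.toFun (X.act x 1) = g.toFun (X.act x 1) :=
    congrFun he (Quotient.mk (amalgSetoid I) (true, 1))
  rwa [X.act_one] at key

/-- A tossing between the two copies of `1` passes through the amalgamated ideal. -/
theorem exists_mem_mul_eq_of_tossLe_amalg {S : Type} [Monoid S] [PartialOrder S]
    [CovariantClass S S (· * ·) (· ≤ ·)]
    [CovariantClass S S (Function.swap (· * ·)) (· ≤ ·)]
    {I : Set S} {hI : ∀ i ∈ I, ∀ t, i * t ∈ I} {B : Set S} {b : S}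
    (h : (amalg I hI).TossLe B (Quotient.mk (amalgSetoid I) (true, 1)) b
      (Quotient.mk (amalgSetoid I) (false, 1)) b) :
    ∃ i ∈ I, ∃ u ∈ B, i * u = b := by
  obtain ⟨n, c, s, t, u, hu₀, hu₁, huB, hstart, hstep, hend, hst⟩ := h
  choose d hd using fun i => Quotient.exists_rep (c i)
  obtain rfl : (fun i => Quotient.mk (amalgSetoid I) (d i)) = c := funext hd
  have hstart : AmalgLe I (true, 1) ((d 0).1, (d 0).2 * s 0) := hstart
  have hstep (i : Fin n) : AmalgLe I ((d i.castSucc).1, (d i.castSucc).2 * t i.castSucc)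
      ((d i.succ).1, (d i.succ).2 * s i.succ) := hstep i
  have hend : AmalgLe I ((d (Fin.last n)).1, (d (Fin.last n)).2 * t (Fin.last n))
      (false, 1) := hend
  have mono {x y : S} (z : S) (hxy : x ≤ y) : x * z ≤ y * z :=
    CovariantClass.elim (μ := Function.swap (· * ·)) z hxy
  let v (i : Fin (n + 1)) : S := (d i).2 * s i * u i.castSucc
  let w (i : Fin (n + 1)) : S := (d i).2 * t i * u i.succ
  have hvw (i : Fin (n + 1)) : v i ≤ w i := by
    simpa only [v, w, mul_assoc] using
      CovariantClass.elim (μ := (· * ·)) (r := (· ≤ ·)) (d i).2 (hst i)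
  have hwv (i : Fin n) : w i.castSucc ≤ v i.succ := mono _ (hstep i).1
  have hv : Monotone v := Fin.monotone_iff_le_succ.mpr fun i => (hvw _).trans (hwv i)
  have hbv : b ≤ v 0 := by simpa [v, hu₀] using mono (u 0) hstart.1
  have hwb : w (Fin.last n) ≤ b := by
    simpa [w, hu₁] using mono (u (Fin.last (n + 1))) hend.1
  have hlo (i : Fin (n + 1)) : b ≤ v i := hbv.trans (hv (Fin.zero_le i))
  have hhi (i : Fin (n + 1)) : v i ≤ b := (hv (Fin.le_last i)).trans ((hvw _).trans hwb)
  by_contra hne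
  have color (i : Fin (n + 1)) : (d i).1 = true := by
    induction i using Fin.induction with
    | zero =>
      rcases hstart.2 with h | ⟨i, hi, h₁, h₂⟩
      · exact h.symm
      · refine absurd ⟨i, hi, u 0, huB 0, _root_.le_antisymm ?_ ?_⟩ hne
        · exact (mono (u 0) h₂).trans (hhi 0)
        · simpa [hu₀] using mono (u 0) h₁
    | succ j ih =>
      rcases (hstep j).2 with h | ⟨i, hi, h₁, h₂⟩
      · exact h.symm.trans ih
      · refine absurd ⟨i, hi, u j.succ.castSucc, huB _, _root_.le_antisymm ?_ ?_⟩ hne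
        · exact (mono _ h₂).trans (hhi j.succ)
        · exact ((hlo _).trans (hvw j.castSucc)).trans (mono _ h₁)
  rcases hend.2 with h | ⟨i, hi, h₁, h₂⟩
  · exact Bool.noConfusion ((color (Fin.last n)).symm.trans h)
  · refine hne ⟨i, hi, u (Fin.last (n + 1)), huB _, _root_.le_antisymm ?_ ?_⟩
    · simpa [hu₁] using mono (u (Fin.last (n + 1))) h₂
    · exact ((hlo _).trans (hvw (Fin.last n))).trans (mono _ h₁)

end SPoset

/-- if all generators in `Pos`-`S` are principally weakly
po-flat, then `S` is regular. -/
theorem regular_of_generators_pwpf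
    {S : Type} [Monoid S] [PartialOrder S]
    [CovariantClass S S (· * ·) (· ≤ ·)]
    [CovariantClass S S (Function.swap (· * ·)) (· ≤ ·)]
    (hgen : ∀ G : SPoset S, IsGenerator G → G.PWPoFlat) :
    ∀ s : S, ∃ x : S, s = s * x * s := by
  intro s
  let I : Set S := {i | ∃ r, i = s * r}
  have hI : ∀ i ∈ I, ∀ t, i * t ∈ I := by
    rintro _ ⟨r, rfl⟩ t
    exact ⟨r * t, mul_assoc s r t⟩
  have hle : SPoset.AmalgLe I (true, 1 * s) (false, 1 * s) :=
    ⟨le_rfl, Or.inr ⟨1 * s, ⟨1, by rw [one_mul, mul_one]⟩, le_rfl, le_rfl⟩⟩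
  obtain ⟨_, ⟨r, rfl⟩, _, ⟨w, rfl⟩, h⟩ := SPoset.exists_mem_mul_eq_of_tossLe_amalg
    (hgen (SPoset.amalg I hI) (SPoset.isGenerator_amalg I hI)
      (Quotient.mk _ (true, 1)) (Quotient.mk _ (false, 1)) s hle)
  exact ⟨r * w, by simpa only [mul_assoc] using h.symm⟩
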